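/- Necessity in the ISS characterization: Let h be a strictly inverse S-shaped distortion function with inflection point p∈(0,1). If a copula C is universally optimal for h with linear cost, then C = C^±_p and the right derivatives satisfy h'(p⁺) ≥ h'(0⁺). -/

import Mathlib

open MeasureTheory Set ProbabilityTheory

noncomputable section

variable {Ω : Type*} [MeasurableSpace Ω]

/-- An atomless probability measure: every non-null measurable set has a measurable
subset of strictly smaller positive measure. -/
def AtomlessProb (P : Measure Ω) : Prop :=
  ∀ A : Set Ω, MeasurableSet A → 0 < P A →
    ∃ B ⊆ A, MeasurableSet B ∧ 0 < P B ∧ P B < P A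

/-- A distortion function: increasing on `[0,1]` with `h 0 = 0` and `h 1 = 1`. -/
def IsDistortion (h : ℝ → ℝ) : Prop :=
  MonotoneOn h (Icc 0 1) ∧ h 0 = 0 ∧ h 1 = 1

/-- The distorted expectation `E^h[Z]`. -/
def distExp (P : Measure Ω) (h : ℝ → ℝ) (Z : Ω → ℝ) : ℝ :=
  (∫ x in Ioi (0:ℝ), h (P {ω | Z ω > x}).toReal) +
  (∫ x in Iio (0:ℝ), (h (P {ω | Z ω > x}).toReal - 1))

/-- Bounded measurable real random variable. -/
def IsBddRV (X : Ω → ℝ) : Prop :=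
  Measurable X ∧ ∃ M : ℝ, ∀ ω, |X ω| ≤ M

/-- X and Y are comonotonic. -/
def Comonotone (P : Measure Ω) (X Y : Ω → ℝ) : Prop :=
  ∃ f g : ℝ → ℝ, Monotone f ∧ Monotone g ∧
    ∀ᵐ ω ∂P, X ω = f (X ω + Y ω) ∧ Y ω = g (X ω + Y ω)

/-- X and Y are counter-monotonic: X and -Y are comonotonic. -/
def CounterMonotone (P : Measure Ω) (X Y : Ω → ℝ) : Prop :=
  Comonotone P X (fun ω => -Y ω)

def Submodular (c : ℝ → ℝ → ℝ) : Prop :=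
  ∀ x₁ y₁ x₂ y₂ : ℝ,
    c (min x₁ x₂) (min y₁ y₂) + c (max x₁ x₂) (max y₁ y₂) ≤ c x₁ y₁ + c x₂ y₂

def Supermodular (c : ℝ → ℝ → ℝ) : Prop :=
  ∀ x₁ y₁ x₂ y₂ : ℝ,
    c x₁ y₁ + c x₂ y₂ ≤ c (min x₁ x₂) (min y₁ y₂) + c (max x₁ x₂) (max y₁ y₂)

/-- c is monotone: increasing in each argument or decreasing in each argument. -/
def MonotoneCost (c : ℝ → ℝ → ℝ) : Prop :=
  Monotone (fun q : ℝ × ℝ => c q.1 q.2) ∨ Antitone (fun q : ℝ × ℝ => c q.1 q.2)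

/-- A 2-copula. -/
def IsCopula (C : ℝ → ℝ → ℝ) : Prop :=
  (∀ u ∈ Icc (0:ℝ) 1, C u 0 = 0 ∧ C 0 u = 0 ∧ C u 1 = u ∧ C 1 u = u) ∧
  (∀ u₁ u₂ v₁ v₂ : ℝ, u₁ ∈ Icc (0:ℝ) 1 → u₂ ∈ Icc (0:ℝ) 1 →
    v₁ ∈ Icc (0:ℝ) 1 → v₂ ∈ Icc (0:ℝ) 1 → u₁ ≤ u₂ → v₁ ≤ v₂ →
    0 ≤ C u₂ v₂ - C u₂ v₁ - C u₁ v₂ + C u₁ v₁)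

/-- (X, Y) has copula C. -/
def HasCopula (P : Measure Ω) (X Y : Ω → ℝ) (C : ℝ → ℝ → ℝ) : Prop :=
  ∀ x y : ℝ, (P {ω | X ω ≤ x ∧ Y ω ≤ y}).toReal =
    C (P {ω | X ω ≤ x}).toReal (P {ω | Y ω ≤ y}).toReal

/-- C is universally optimal for h with linear cost. -/
def UnivOptimal (P : Measure Ω) (h : ℝ → ℝ) (C : ℝ → ℝ → ℝ) : Prop :=
  ∀ X Y X' Y' : Ω → ℝ, IsBddRV X → IsBddRV Y → IsBddRV X' → IsBddRV Y' →
    HasCopula P X Y C → IdentDistrib X X' P P → IdentDistrib Y Y' P P →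
    distExp P h (fun ω => X ω + Y ω) ≤ distExp P h (fun ω => X' ω + Y' ω)

/-- C is universally maximal for h with linear cost. -/
def UnivMaximal (P : Measure Ω) (h : ℝ → ℝ) (C : ℝ → ℝ → ℝ) : Prop :=
  ∀ X Y X' Y' : Ω → ℝ, IsBddRV X → IsBddRV Y → IsBddRV X' → IsBddRV Y' →
    HasCopula P X Y C → IdentDistrib X X' P P → IdentDistrib Y Y' P P →
    distExp P h (fun ω => X' ω + Y' ω) ≤ distExp P h (fun ω => X ω + Y ω)

/-- C is universally optimal within a class 𝒞 of copulas for h with linear cost. -/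
def UnivOptimalWithin (P : Measure Ω) (h : ℝ → ℝ) (C : ℝ → ℝ → ℝ)
    (𝒞 : Set (ℝ → ℝ → ℝ)) : Prop :=
  ∀ X Y X' Y' : Ω → ℝ, IsBddRV X → IsBddRV Y → IsBddRV X' → IsBddRV Y' →
    HasCopula P X Y C → (∃ C' ∈ 𝒞, HasCopula P X' Y' C') →
    IdentDistrib X X' P P → IdentDistrib Y Y' P P →
    distExp P h (fun ω => X ω + Y ω) ≤ distExp P h (fun ω => X' ω + Y' ω)

/-- C is universally maximal within a class 𝒞 of copulas for h with linear cost. -/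
def UnivMaximalWithin (P : Measure Ω) (h : ℝ → ℝ) (C : ℝ → ℝ → ℝ)
    (𝒞 : Set (ℝ → ℝ → ℝ)) : Prop :=
  ∀ X Y X' Y' : Ω → ℝ, IsBddRV X → IsBddRV Y → IsBddRV X' → IsBddRV Y' →
    HasCopula P X Y C → (∃ C' ∈ 𝒞, HasCopula P X' Y' C') →
    IdentDistrib X X' P P → IdentDistrib Y Y' P P →
    distExp P h (fun ω => X' ω + Y' ω) ≤ distExp P h (fun ω => X ω + Y ω)

/-- The set 𝒞_p of copulas C with C(1-p,1-p) = 1-p. -/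
def copulaSet (p : ℝ) : Set (ℝ → ℝ → ℝ) :=
  {C | IsCopula C ∧ C (1 - p) (1 - p) = 1 - p}

/-- The "first comonotonic, then counter-monotonic" copula C^±_p. -/
def Cpm (p : ℝ) (u v : ℝ) : ℝ :=
  if min u v ≤ 1 - p then min u v else max (u + v - 1) (1 - p)

/-- The "first counter-monotonic, then comonotonic" copula C^∓_p. -/
def Cmp (p : ℝ) (u v : ℝ) : ℝ :=
  if max u v ≤ 1 - p then max (u + v - 1 + p) 0 else min u v

/-- Inverse S-shaped distortion with inflection point p: continuous, concave on (0,p),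
convex on (p,1). -/
def IsISS (h : ℝ → ℝ) (p : ℝ) : Prop :=
  ContinuousOn h (Icc 0 1) ∧ ConcaveOn ℝ (Ioo 0 p) h ∧ ConvexOn ℝ (Ioo p 1) h

/-- Strictly inverse S-shaped distortion with inflection point p. -/
def IsStrictISS (h : ℝ → ℝ) (p : ℝ) : Prop :=
  ContinuousOn h (Icc 0 1) ∧ StrictConcaveOn ℝ (Ioo 0 p) h ∧ StrictConvexOn ℝ (Ioo p 1) h

/-- S-shaped distortion with inflection point p: continuous, convex on (0,p),
concave on (p,1). -/
def IsSS (h : ℝ → ℝ) (p : ℝ) : Prop :=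
  ContinuousOn h (Icc 0 1) ∧ ConvexOn ℝ (Ioo 0 p) h ∧ ConcaveOn ℝ (Ioo p 1) h

/-- Strictly S-shaped distortion with inflection point p. -/
def IsStrictSS (h : ℝ → ℝ) (p : ℝ) : Prop :=
  ContinuousOn h (Icc 0 1) ∧ StrictConvexOn ℝ (Ioo 0 p) h ∧ StrictConcaveOn ℝ (Ioo p 1) h

/-- Left quantile of Z at level t. -/
def leftQuantile (P : Measure Ω) (Z : Ω → ℝ) (t : ℝ) : ℝ :=
  sInf {x : ℝ | t ≤ (P {ω | Z ω ≤ x}).toReal}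

/-- W is (a version of) the upper p-tail transform Z^∨_p of Z: its left-quantile
function is t ↦ Q_{(1-p)+pt}(Z). -/
def IsUpperTail (P : Measure Ω) (p : ℝ) (Z W : Ω → ℝ) : Prop :=
  ∀ t ∈ Ioc (0:ℝ) 1, leftQuantile P W t = leftQuantile P Z ((1 - p) + p * t)

/-- W is (a version of) the lower tail transform Z^∧_p of Z: its left-quantile
function is t ↦ Q_{(1-p)t}(Z). -/
def IsLowerTail (P : Measure Ω) (p : ℝ) (Z W : Ω → ℝ) : Prop :=
  ∀ t ∈ Ioc (0:ℝ) 1, leftQuantile P W t = leftQuantile P Z ((1 - p) * t)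

/-- Expected Shortfall at level p. -/
def ES (P : Measure Ω) (p : ℝ) (Z : Ω → ℝ) : ℝ :=
  (1 / (1 - p)) * ∫ r in p..1, leftQuantile P Z r

theorem AtomlessProb.exists_subset_half {P : Measure Ω} [IsProbabilityMeasure P]
    (hP : AtomlessProb P) {A : Set Ω} (hA : MeasurableSet A) (hpos : 0 < P.real A) :
    ∃ B ⊆ A, MeasurableSet B ∧ 0 < P.real B ∧ P.real B ≤ P.real A / 2 := by
  have hpos' : 0 < P A := by
    rw [pos_iff_ne_zero]
    intro h0
    simp [Measure.real, h0] at hpos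
  obtain ⟨B, hBA, hB, hB0, hBlt⟩ := hP A hA hpos'
  have hB0' : 0 < P.real B := ENNReal.toReal_pos hB0.ne' (measure_ne_top _ _)
  have hBlt' : P.real B < P.real A :=
    (ENNReal.toReal_lt_toReal (measure_ne_top _ _) (measure_ne_top _ _)).2 hBlt
  by_cases hle : P.real B ≤ P.real A / 2
  · exact ⟨B, hBA, hB, hB0', hle⟩
  · have hd : P.real (A \ B) = P.real A - P.real B := measureReal_sdiff hBA hB
    exact ⟨A \ B, sdiff_subset, hA.diff hB, by linarith, by linarith⟩

theorem AtomlessProb.exists_subset_pos_le {P : Measure Ω} [IsProbabilityMeasure P]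
    (hP : AtomlessProb P) {A : Set Ω} (hA : MeasurableSet A) (hpos : 0 < P.real A)
    {ε : ℝ} (hε : 0 < ε) :
    ∃ B ⊆ A, MeasurableSet B ∧ 0 < P.real B ∧ P.real B ≤ ε := by
  have key : ∀ n : ℕ, ∃ B ⊆ A, MeasurableSet B ∧ 0 < P.real B ∧ P.real B ≤ (1 / 2) ^ n := by
    intro n
    induction n with
    | zero => exact ⟨A, Subset.rfl, hA, hpos, by simp [measureReal_le_one]⟩
    | succ n ih =>
      obtain ⟨B, hBA, hB, hB0, hBn⟩ := ih
      obtain ⟨D, hDB, hD, hD0, hDB2⟩ := hP.exists_subset_half hB hB0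
      exact ⟨D, hDB.trans hBA, hD, hD0, by rw [pow_succ]; linarith⟩
  obtain ⟨n, hn⟩ := exists_pow_lt_of_lt_one hε (by norm_num : (1 / 2 : ℝ) < 1)
  obtain ⟨B, hBA, hB, hB0, hBn⟩ := key n
  exact ⟨B, hBA, hB, hB0, hBn.trans hn.le⟩

/-- Sierpiński's theorem: an atomless probability measure takes every intermediate value on the
measurable subsets of a measurable set. -/
theorem AtomlessProb.exists_subset_measureReal_eq {P : Measure Ω} [IsProbabilityMeasure P]
    (hP : AtomlessProb P) {A : Set Ω} (hA : MeasurableSet A) {t : ℝ} (ht0 : 0 ≤ t)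
    (htA : t ≤ P.real A) :
    ∃ B ⊆ A, MeasurableSet B ∧ P.real B = t := by
  let S := {E : Set Ω // MeasurableSet E ∧ E ⊆ A ∧ P.real E ≤ t}
  have step : ∀ E : S, ∃ E' : S, E.1 ⊆ E'.1 ∧ ∀ F : Set Ω, MeasurableSet F → F ⊆ A \ E.1 →
      P.real E.1 + P.real F ≤ t → P.real F ≤ 2 * (P.real E'.1 - P.real E.1) := by
    rintro ⟨E, hE, hEA, hEt⟩
    let T : Set ℝ := {r | ∃ F, MeasurableSet F ∧ F ⊆ A \ E ∧ P.real E + P.real F ≤ t ∧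
      r = P.real F}
    have hbdd : BddAbove T := ⟨1, by rintro r ⟨F, -, -, -, rfl⟩; exact measureReal_le_one⟩
    by_cases hs : sSup T ≤ 0
    · refine ⟨⟨E, hE, hEA, hEt⟩, Subset.rfl, fun F hF hFE hFt => ?_⟩
      have := le_csSup hbdd ⟨F, hF, hFE, hFt, rfl⟩
      simp only [sub_self, mul_zero]
      linarith
    · have hne : T.Nonempty := ⟨0, ∅, MeasurableSet.empty, empty_subset _, by simpa, by simp⟩
      obtain ⟨r, ⟨G, hG, hGE, hGt, rfl⟩, hr⟩ :=
        exists_lt_of_lt_csSup hne (show sSup T / 2 < sSup T by linarith)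
      have hun : P.real (E ∪ G) = P.real E + P.real G :=
        measureReal_union (disjoint_of_subset_right hGE disjoint_sdiff_right) hG
      refine ⟨⟨E ∪ G, hE.union hG, union_subset hEA (hGE.trans sdiff_subset), by linarith⟩,
        subset_union_left, fun F hF hFE hFt => ?_⟩
      have := le_csSup hbdd ⟨F, hF, hFE, hFt, rfl⟩
      simp only
      linarith
  choose next hsub hnext using step
  let e : ℕ → S := fun n =>
    Nat.rec ⟨∅, MeasurableSet.empty, empty_subset _, by simpa⟩ (fun _ E => next E) n
  have hmono : Monotone fun n => (e n).1 := monotone_nat_of_le_succ fun n => hsub (e n)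
  let U := ⋃ n, (e n).1
  have hU : MeasurableSet U := MeasurableSet.iUnion fun n => (e n).2.1
  have hUA : U ⊆ A := iUnion_subset fun n => (e n).2.2.1
  have hlim : Filter.Tendsto (fun n => P.real (e n).1) Filter.atTop (nhds (P.real U)) :=
    (ENNReal.tendsto_toReal (measure_ne_top _ _)).comp (tendsto_measure_iUnion_atTop hmono)
  have hUt : P.real U ≤ t := le_of_tendsto' hlim fun n => (e n).2.2.2
  refine ⟨U, hUA, hU, hUt.antisymm ?_⟩
  by_contra! hlt
  have hd : P.real (A \ U) = P.real A - P.real U := measureReal_sdiff hUA hU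
  obtain ⟨F, hFU, hF, hF0, hFt⟩ := hP.exists_subset_pos_le (hA.diff hU) (by linarith)
    (show 0 < t - P.real U by linarith)
  have hinc : ∀ n, P.real F ≤ 2 * (P.real (e (n + 1)).1 - P.real (e n).1) := fun n => by
    have hle : P.real (e n).1 ≤ P.real U := measureReal_mono (subset_iUnion (fun n => (e n).1) n)
    exact hnext (e n) F hF
      (hFU.trans (sdiff_subset_sdiff_right (subset_iUnion (fun n => (e n).1) n))) (by linarith)
  have hzero : Filter.Tendsto (fun n => 2 * (P.real (e (n + 1)).1 - P.real (e n).1))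
      Filter.atTop (nhds (2 * (P.real U - P.real U))) :=
    ((hlim.comp (Filter.tendsto_add_atTop_nat 1)).sub hlim).const_mul 2
  have := ge_of_tendsto' hzero hinc
  linarith

/-- Two events with prescribed probabilities and prescribed probability of their intersection. -/
theorem AtomlessProb.exists_events {P : Measure Ω} [IsProbabilityMeasure P]
    (hP : AtomlessProb P) {a b c : ℝ} (hc0 : 0 ≤ c) (hca : c ≤ a) (hcb : c ≤ b)
    (hab : a + b - 1 ≤ c) :
    ∃ A B : Set Ω, MeasurableSet A ∧ MeasurableSet B ∧ P.real A = a ∧ P.real B = b ∧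
      P.real (A ∩ B) = c := by
  obtain ⟨A, -, hA, hAa⟩ := hP.exists_subset_measureReal_eq (t := a) MeasurableSet.univ
    (by linarith) (by rw [probReal_univ]; linarith)
  obtain ⟨I, hIA, hI, hIc⟩ := hP.exists_subset_measureReal_eq hA hc0 (hAa ▸ hca)
  obtain ⟨J, hJA, hJ, hJb⟩ := hP.exists_subset_measureReal_eq (t := b - c) hA.compl
    (by linarith) (by rw [probReal_compl_eq_one_sub hA]; linarith)
  have hdisj : Disjoint I J := disjoint_of_subset hIA hJA disjoint_compl_right
  refine ⟨A, I ∪ J, hA, hI.union hJ, hAa, ?_, ?_⟩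
  · rw [measureReal_union hdisj hJ]; linarith
  · have : A ∩ (I ∪ J) = I := by
      ext ω
      have h1 := @hIA ω
      have h2 := @hJA ω
      simp only [mem_inter_iff, mem_union, mem_compl_iff] at *
      tauto
    rw [this, hIc]

theorem setOf_indicator_one_le {α : Type*} (A : Set α) (x : ℝ) :
    {ω | A.indicator (fun _ => (1 : ℝ)) ω ≤ x} =
      if x < 0 then ∅ else if x < 1 then Aᶜ else univ := by
  ext ω
  by_cases hω : ω ∈ A <;> split_ifs <;> simp [hω] <;> linarith

theorem isBddRV_indicator_one {A : Set Ω} (hA : MeasurableSet A) :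
    IsBddRV (A.indicator fun _ => (1 : ℝ)) :=
  ⟨measurable_const.indicator hA, 1, fun ω => by by_cases hω : ω ∈ A <;> simp [hω]⟩

theorem identDistrib_indicator_one {P : Measure Ω} [IsProbabilityMeasure P] {A B : Set Ω}
    (hA : MeasurableSet A) (hB : MeasurableSet B) (hAB : P.real A = P.real B) :
    IdentDistrib (A.indicator fun _ => (1 : ℝ)) (B.indicator fun _ => (1 : ℝ)) P P := by
  have mA := (isBddRV_indicator_one hA).1
  have mB := (isBddRV_indicator_one hB).1
  refine ⟨mA.aemeasurable, mB.aemeasurable, ?_⟩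
  have := Measure.isFiniteMeasure_map P (A.indicator fun _ => (1 : ℝ))
  refine Measure.ext_of_Iic _ _ fun x => ?_
  rw [Measure.map_apply mA measurableSet_Iic, Measure.map_apply mB measurableSet_Iic]
  change P {ω | _ ≤ x} = P {ω | _ ≤ x}
  have hc : P Aᶜ = P Bᶜ := by
    rw [← ENNReal.toReal_eq_toReal_iff' (measure_ne_top _ _) (measure_ne_top _ _)]
    change P.real _ = P.real _
    rw [probReal_compl_eq_one_sub hA, probReal_compl_eq_one_sub hB, hAB]
  rw [setOf_indicator_one_le, setOf_indicator_one_le]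
  split_ifs <;> simp [hc]

theorem hasCopula_indicator_one {P : Measure Ω} [IsProbabilityMeasure P] {C : ℝ → ℝ → ℝ}
    (hC : IsCopula C) {A B : Set Ω}
    (hAB : P.real (Aᶜ ∩ Bᶜ) = C (P.real Aᶜ) (P.real Bᶜ)) :
    HasCopula P (A.indicator fun _ => (1 : ℝ)) (B.indicator fun _ => (1 : ℝ)) C := by
  intro x y
  rw [ofPred_and, setOf_indicator_one_le, setOf_indicator_one_le]
  change P.real _ = C (P.real _) (P.real _)
  have hA' : P.real Aᶜ ∈ Icc (0 : ℝ) 1 := ⟨measureReal_nonneg, measureReal_le_one⟩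
  have hB' : P.real Bᶜ ∈ Icc (0 : ℝ) 1 := ⟨measureReal_nonneg, measureReal_le_one⟩
  have h0 : (0 : ℝ) ∈ Icc (0 : ℝ) 1 := by simp
  have h1 : (1 : ℝ) ∈ Icc (0 : ℝ) 1 := by simp
  obtain ⟨a0, a1, a2, a3⟩ := hC.1 _ hA'
  obtain ⟨b0, b1, b2, b3⟩ := hC.1 _ hB'
  obtain ⟨c0, c1, c2, c3⟩ := hC.1 _ h0
  obtain ⟨d0, d1, d2, d3⟩ := hC.1 _ h1
  split_ifs <;> simp_all

theorem distExp_indicator_add_indicator {P : Measure Ω} [IsProbabilityMeasure P] {h : ℝ → ℝ}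
    (hdist : IsDistortion h) (A B : Set Ω) :
    distExp P h (fun ω => A.indicator (fun _ => (1 : ℝ)) ω + B.indicator (fun _ => (1 : ℝ)) ω) =
      h (P.real (A ∪ B)) + h (P.real (A ∩ B)) := by
  obtain ⟨-, hh0, hh1⟩ := hdist
  set Z : Ω → ℝ := fun ω => A.indicator (fun _ => (1 : ℝ)) ω + B.indicator (fun _ => (1 : ℝ)) ω
    with hZ
  have hneg : ∀ x : ℝ, x < 0 → {ω | Z ω > x} = univ := fun x hx => by
    ext ω
    by_cases h1 : ω ∈ A <;> by_cases h2 : ω ∈ B <;> simp [hZ, h1, h2] <;> linarith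
  have hlow : ∀ x : ℝ, 0 ≤ x → x < 1 → {ω | Z ω > x} = A ∪ B := fun x hx hx1 => by
    ext ω
    by_cases h1 : ω ∈ A <;> by_cases h2 : ω ∈ B <;> simp [hZ, h1, h2] <;> linarith
  have hmid : ∀ x : ℝ, 1 ≤ x → x < 2 → {ω | Z ω > x} = A ∩ B := fun x hx hx1 => by
    ext ω
    by_cases h1 : ω ∈ A <;> by_cases h2 : ω ∈ B <;> simp [hZ, h1, h2] <;> linarith
  have hhigh : ∀ x : ℝ, 2 ≤ x → {ω | Z ω > x} = ∅ := fun x hx => by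
    ext ω
    by_cases h1 : ω ∈ A <;> by_cases h2 : ω ∈ B <;> simp [hZ, h1, h2] <;> linarith
  have hsecond : ∫ x in Iio (0 : ℝ), (h (P {ω | Z ω > x}).toReal - 1) = 0 := by
    rw [setIntegral_congr_fun (g := fun _ => (0 : ℝ)) measurableSet_Iio]
    · simp
    · intro x hx
      simp [hneg x hx, hh1]
  have hfirst : ∫ x in Ioi (0 : ℝ), h (P {ω | Z ω > x}).toReal =
      ∫ x in Ioi (0 : ℝ), ((Ico (0 : ℝ) 1).indicator (fun _ => h (P.real (A ∪ B))) x +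
        (Ico (1 : ℝ) 2).indicator (fun _ => h (P.real (A ∩ B))) x) := by
    refine setIntegral_congr_fun measurableSet_Ioi fun x (hx : 0 < x) => ?_
    by_cases h1 : x < 1
    · have h2 : ¬ (1 : ℝ) ≤ x := not_le.2 h1
      rw [hlow x hx.le h1]
      simp [indicator, hx.le, h1, h2, Measure.real]
    · by_cases h2 : x < 2
      · rw [hmid x (not_lt.1 h1) h2]
        simp [indicator, h1, h2, not_lt.1 h1, Measure.real]
      · rw [hhigh x (not_lt.1 h2)]
        simp [indicator, h1, h2, hh0]
  have hint : ∀ a b k : ℝ, Integrable ((Ico a b).indicator fun _ => k)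
      (volume.restrict (Ioi (0 : ℝ))) := fun a b k => by
    refine Integrable.integrableOn ?_
    rw [integrable_indicator_iff measurableSet_Ico]
    exact integrableOn_const (by simp)
  have hinter1 : volume.real (Ioi (0 : ℝ) ∩ Ico 0 1) = 1 := by
    have : Ioi (0 : ℝ) ∩ Ico 0 1 = Ioo 0 1 := by
      ext x
      simp only [mem_inter_iff, mem_Ioi, mem_Ico, mem_Ioo]
      grind
    rw [this]
    simp
  have hinter2 : volume.real (Ioi (0 : ℝ) ∩ Ico 1 2) = 1 := by
    have : Ioi (0 : ℝ) ∩ Ico 1 2 = Ico 1 2 :=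
      inter_eq_right.2 fun x hx => lt_of_lt_of_le one_pos hx.1
    rw [this]
    norm_num
  rw [distExp, hsecond, hfirst, integral_add (hint _ _ _) (hint _ _ _),
    setIntegral_indicator measurableSet_Ico, setIntegral_indicator measurableSet_Ico]
  simp [hinter1, hinter2]

/-- The probability that both of two events of probabilities `a` and `b` occur, when they are
the upper events of a pair of random variables with copula `C`. -/
def upperJoint (C : ℝ → ℝ → ℝ) (a b : ℝ) : ℝ := a + b - 1 + C (1 - a) (1 - b)

theorem IsCopula.mono_right {C : ℝ → ℝ → ℝ} (hC : IsCopula C) {u v w : ℝ}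
    (hu : u ∈ Icc (0 : ℝ) 1) (hv : v ∈ Icc (0 : ℝ) 1) (hw : w ∈ Icc (0 : ℝ) 1) (hvw : v ≤ w) :
    C u v ≤ C u w ∧ C u w ≤ C u v + (w - v) := by
  have h1 := hC.2 0 u v w (by simp) hu hv hw hu.1 hvw
  have h2 := hC.2 u 1 v w hu (by simp) hv hw hu.2 hvw
  have hv' := hC.1 v hv
  have hw' := hC.1 w hw
  constructor <;> linarith

theorem IsCopula.mono_left {C : ℝ → ℝ → ℝ} (hC : IsCopula C) {u v w : ℝ}
    (hu : u ∈ Icc (0 : ℝ) 1) (hv : v ∈ Icc (0 : ℝ) 1) (hw : w ∈ Icc (0 : ℝ) 1) (hvw : v ≤ w) :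
    C v u ≤ C w u ∧ C w u ≤ C v u + (w - v) := by
  have h1 := hC.2 v w 0 u hv hw (by simp) hu hvw hu.1
  have h2 := hC.2 v w u 1 hv hw hu (by simp) hvw hu.2
  have hv' := hC.1 v hv
  have hw' := hC.1 w hw
  constructor <;> linarith

theorem IsCopula.le_min {C : ℝ → ℝ → ℝ} (hC : IsCopula C) {u v : ℝ}
    (hu : u ∈ Icc (0 : ℝ) 1) (hv : v ∈ Icc (0 : ℝ) 1) : C u v ≤ min u v := by
  have h1 := (hC.mono_right hu hv (by simp : (1 : ℝ) ∈ Icc (0 : ℝ) 1) hv.2).1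
  have h2 := (hC.mono_left hv hu (by simp : (1 : ℝ) ∈ Icc (0 : ℝ) 1) hu.2).1
  rw [(hC.1 u hu).2.2.1] at h1
  rw [(hC.1 v hv).2.2.2] at h2
  exact _root_.le_min h1 h2

theorem IsCopula.max_le {C : ℝ → ℝ → ℝ} (hC : IsCopula C) {u v : ℝ}
    (hu : u ∈ Icc (0 : ℝ) 1) (hv : v ∈ Icc (0 : ℝ) 1) : max (u + v - 1) 0 ≤ C u v := by
  have h1 := (hC.mono_right hu hv (by simp : (1 : ℝ) ∈ Icc (0 : ℝ) 1) hv.2).2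
  have h2 := (hC.mono_right hu (by simp : (0 : ℝ) ∈ Icc (0 : ℝ) 1) hv hv.1).1
  rw [(hC.1 u hu).2.2.1] at h1
  rw [(hC.1 u hu).1] at h2
  exact _root_.max_le (by linarith) h2

/-- Universal optimality tested on indicator variables. -/
theorem UnivOptimal.upperJoint_le {P : Measure Ω} [IsProbabilityMeasure P] (hP : AtomlessProb P)
    {h : ℝ → ℝ} (hdist : IsDistortion h) {C : ℝ → ℝ → ℝ} (hC : IsCopula C)
    (hopt : UnivOptimal P h C) {a b c : ℝ}
    (hc0 : 0 ≤ c) (hca : c ≤ a) (hcb : c ≤ b) (hab : a + b - 1 ≤ c) :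
    h (a + b - upperJoint C a b) + h (upperJoint C a b) ≤ h (a + b - c) + h c := by
  have ha' : 1 - a ∈ Icc (0 : ℝ) 1 := ⟨by linarith, by linarith⟩
  have hb' : 1 - b ∈ Icc (0 : ℝ) 1 := ⟨by linarith, by linarith⟩
  obtain ⟨u1, u2⟩ := le_min_iff.1 (hC.le_min ha' hb')
  obtain ⟨l1, l2⟩ := max_le_iff.1 (hC.max_le ha' hb')
  obtain ⟨A, B, hA, hB, hAa, hBb, hAB⟩ := hP.exists_events (a := a) (b := b)
    (c := upperJoint C a b) (by unfold upperJoint; linarith) (by unfold upperJoint; linarith)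
    (by unfold upperJoint; linarith) (by unfold upperJoint; linarith)
  obtain ⟨A', B', hA', hB', hAa', hBb', hAB'⟩ := hP.exists_events hc0 hca hcb hab
  have hun := measureReal_union_add_inter (μ := P) (s := A) hB
  have hun' := measureReal_union_add_inter (μ := P) (s := A') hB'
  have hcop : HasCopula P (A.indicator fun _ => (1 : ℝ)) (B.indicator fun _ => (1 : ℝ)) C := by
    refine hasCopula_indicator_one hC ?_
    rw [← compl_union, probReal_compl_eq_one_sub (hA.union hB), probReal_compl_eq_one_sub hA,
      probReal_compl_eq_one_sub hB, hAa, hBb]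
    rw [hAB, upperJoint] at hun
    linarith
  have key := hopt _ _ _ _ (isBddRV_indicator_one hA) (isBddRV_indicator_one hB)
    (isBddRV_indicator_one hA') (isBddRV_indicator_one hB') hcop
    (identDistrib_indicator_one hA hA' (hAa.trans hAa'.symm))
    (identDistrib_indicator_one hB hB' (hBb.trans hBb'.symm))
  rw [distExp_indicator_add_indicator hdist, distExp_indicator_add_indicator hdist, hAB, hAB',
    show P.real (A ∪ B) = a + b - upperJoint C a b by linarith,
    show P.real (A' ∪ B') = a + b - c by linarith] at key
  exact key

theorem StrictConcaveOn.add_lt_add {f : ℝ → ℝ} {s : Set ℝ} (hf : StrictConcaveOn ℝ s f)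
    {x y z w : ℝ} (hx : x ∈ s) (hw : w ∈ s) (hxy : x < y) (hyw : y < w) (hsum : x + w = y + z) :
    f x + f w < f y + f z := by
  have hpos : 0 < w - x := by linarith
  have e1 : (w - y) / (w - x) + (y - x) / (w - x) = 1 := by field_simp; ring
  have e2 : (y - x) / (w - x) + (w - y) / (w - x) = 1 := by rw [add_comm, e1]
  have p1 : 0 < (w - y) / (w - x) := div_pos (by linarith) hpos
  have p2 : 0 < (y - x) / (w - x) := div_pos (by linarith) hpos
  have h1 := hf.2 hx hw (by linarith : x ≠ w) p1 p2 e1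
  have h2 := hf.2 hx hw (by linarith : x ≠ w) p2 p1 e2
  have r1 : (w - y) / (w - x) * x + (y - x) / (w - x) * w = y := by field_simp; ring
  have r2 : (y - x) / (w - x) * x + (w - y) / (w - x) * w = z := by
    rw [show z = x + w - y by linarith]; field_simp; ring
  simp only [smul_eq_mul, r1, r2] at h1 h2
  calc f x + f w = ((w - y) / (w - x) + (y - x) / (w - x)) * (f x + f w) := by rw [e1, one_mul]
    _ < f y + f z := by linarith

theorem StrictConcaveOn.add_lt_add_of_Ioo {f : ℝ → ℝ} {a b : ℝ}
    (hf : StrictConcaveOn ℝ (Ioo a b) f) (hcont : ContinuousOn f (Icc a b)) {x y z w : ℝ}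
    (hax : a ≤ x) (hwb : w ≤ b) (hxy : x < y) (hyz : y ≤ z) (hsum : x + w = y + z) :
    f x + f w < f y + f z := by
  have hmid : f ((x + y) / 2) + f ((z + w) / 2) < f y + f z :=
    hf.add_lt_add ⟨by linarith, by linarith⟩ ⟨by linarith, by linarith⟩ (by linarith)
      (by linarith) (by linarith)
  refine lt_of_le_of_lt ?_ hmid
  have hlim1 : Filter.Tendsto (fun δ => f (x + δ)) (nhdsWithin 0 (Ioo 0 ((y - x) / 2)))
      (nhds (f x)) := by
    refine (hcont x ⟨hax, by linarith⟩).tendsto.comp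
      (tendsto_nhdsWithin_iff.2 ⟨?_, eventually_nhdsWithin_of_forall fun δ hδ =>
        ⟨by linarith [hδ.1], by linarith [hδ.2]⟩⟩)
    exact ((by fun_prop : Continuous fun δ : ℝ => x + δ).tendsto' 0 x (by simp)).mono_left
      nhdsWithin_le_nhds
  have hlim2 : Filter.Tendsto (fun δ => f (w - δ)) (nhdsWithin 0 (Ioo 0 ((y - x) / 2)))
      (nhds (f w)) := by
    refine (hcont w ⟨by linarith, hwb⟩).tendsto.comp
      (tendsto_nhdsWithin_iff.2 ⟨?_, eventually_nhdsWithin_of_forall fun δ hδ =>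
        ⟨by linarith [hδ.2], by linarith [hδ.1]⟩⟩)
    exact ((by fun_prop : Continuous fun δ : ℝ => w - δ).tendsto' 0 w (by simp)).mono_left
      nhdsWithin_le_nhds
  have : (nhdsWithin (0 : ℝ) (Ioo 0 ((y - x) / 2))).NeBot := by
    rw [nhdsWithin_Ioo_eq_nhdsGT (by linarith)]
    infer_instance
  refine le_of_tendsto (hlim1.add hlim2) (eventually_nhdsWithin_of_forall fun δ hδ => ?_)
  exact (hf.add_lt_add ⟨by linarith [hδ.1], by linarith [hδ.2]⟩
    ⟨by linarith [hδ.2], by linarith [hδ.1]⟩ (by linarith [hδ.2]) (by linarith [hδ.2])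
    (by linarith)).le

theorem StrictConvexOn.add_lt_add_of_Ioo {f : ℝ → ℝ} {a b : ℝ}
    (hf : StrictConvexOn ℝ (Ioo a b) f) (hcont : ContinuousOn f (Icc a b)) {x y z w : ℝ}
    (hax : a ≤ x) (hwb : w ≤ b) (hxy : x < y) (hyz : y ≤ z) (hsum : x + w = y + z) :
    f y + f z < f x + f w := by
  have := hf.neg.add_lt_add_of_Ioo hcont.neg hax hwb hxy hyz hsum
  simp only [Pi.neg_apply] at this
  linarith

section Necessity

variable {P : Measure Ω} [IsProbabilityMeasure P] {h : ℝ → ℝ} {p : ℝ} {C : ℝ → ℝ → ℝ}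

theorem UnivOptimal.upperJoint_diag_of_inflection_le (hP : AtomlessProb P)
    (hdist : IsDistortion h) (hp : p ∈ Ioo (0 : ℝ) 1) (hiss : IsStrictISS h p) (hC : IsCopula C)
    (hopt : UnivOptimal P h C) {a : ℝ} (ha : a ∈ Icc (0 : ℝ) 1) (hpa : p ≤ upperJoint C a a) :
    upperJoint C a a = a := by
  have hv : 1 - a ∈ Icc (0 : ℝ) 1 := ⟨by linarith [ha.2], by linarith [ha.1]⟩
  have hle := (le_min_iff.1 (hC.le_min hv hv)).1
  have hge := (max_le_iff.1 (hC.max_le hv hv)).2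
  have hopt' := hopt.upperJoint_le hP hdist hC ha.1 le_rfl le_rfl (by linarith [ha.2])
  by_contra hne
  have hlt : upperJoint C a a < a := lt_of_le_of_ne (by unfold upperJoint; linarith) hne
  have hup : a + a - upperJoint C a a ≤ 1 := by
    unfold upperJoint
    linarith
  have := hiss.2.2.add_lt_add_of_Ioo (hiss.1.mono (Icc_subset_Icc_left hp.1.le)) hpa hup hlt
    (le_refl a) (by ring)
  rw [add_sub_cancel_right] at hopt'
  linarith

theorem UnivOptimal.upperJoint_inflection (hP : AtomlessProb P) (hdist : IsDistortion h)
    (hp : p ∈ Ioo (0 : ℝ) 1) (hiss : IsStrictISS h p) (hC : IsCopula C)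
    (hopt : UnivOptimal P h C) :
    upperJoint C p p = p := by
  obtain ⟨hp0, hp1⟩ := hp
  have hq : 1 - p ∈ Icc (0 : ℝ) 1 := ⟨by linarith, by linarith⟩
  have hseq : ∀ n : ℕ, upperJoint C (p + (1 - p) * (1 / 2) ^ n) (p + (1 - p) * (1 / 2) ^ n) =
      p + (1 - p) * (1 / 2) ^ n := by
    intro n
    induction n with
    | zero =>
      have := (hC.1 0 (by simp)).1
      simp [upperJoint, this]
    | succ n ih =>
      have hpow : (0 : ℝ) < (1 / 2) ^ n := by positivity
      have hpow1 : ((1 : ℝ) / 2) ^ n ≤ 1 := pow_le_one₀ (by norm_num) (by norm_num)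
      set r := p + (1 - p) * (1 / 2) ^ n with hr
      set a := p + (1 - p) * (1 / 2) ^ (n + 1) with ha
      have har : 2 * a = r + p := by rw [ha, hr, pow_succ]; ring
      have hrp : p ≤ r := by nlinarith
      have hr1 : r ≤ 1 := by nlinarith
      have hu : 1 - r ∈ Icc (0 : ℝ) 1 := ⟨by linarith, by linarith⟩
      have hv : 1 - a ∈ Icc (0 : ℝ) 1 := ⟨by linarith, by linarith⟩
      have m1 := (hC.mono_right hu hu hv (by linarith)).1
      have m2 := (hC.mono_left hv hu hv (by linarith)).1
      refine hopt.upperJoint_diag_of_inflection_le hP hdist ⟨hp0, hp1⟩ hiss hC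
        ⟨by linarith, by linarith⟩ ?_
      unfold upperJoint at ih ⊢
      linarith
  have hlower : ∀ n : ℕ, 1 - p - 2 * (1 - p) * (1 / 2) ^ n ≤ C (1 - p) (1 - p) := by
    intro n
    have hpow : (0 : ℝ) < (1 / 2) ^ n := by positivity
    have hpow1 : ((1 : ℝ) / 2) ^ n ≤ 1 := pow_le_one₀ (by norm_num) (by norm_num)
    have hs := hseq n
    set r := p + (1 - p) * (1 / 2) ^ n with hr
    have hrp : p ≤ r := by nlinarith
    have hr1 : r ≤ 1 := by nlinarith
    have hu : 1 - r ∈ Icc (0 : ℝ) 1 := ⟨by linarith, by linarith⟩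
    have m1 := (hC.mono_right hu hu hq (by linarith)).1
    have m2 := (hC.mono_left hq hu hq (by linarith)).1
    unfold upperJoint at hs
    nlinarith
  have hlim : Filter.Tendsto (fun n : ℕ => 1 - p - 2 * (1 - p) * (1 / 2) ^ n) Filter.atTop
      (nhds (1 - p - 2 * (1 - p) * 0)) :=
    ((tendsto_pow_atTop_nhds_zero_of_lt_one (by norm_num) (by norm_num)).const_mul _).const_sub _
  have h1 := le_of_tendsto' hlim hlower
  have h2 := (le_min_iff.1 (hC.le_min hq hq)).1
  unfold upperJoint
  linarith

theorem UnivOptimal.upperJoint_of_le_inflection (hP : AtomlessProb P) (hdist : IsDistortion h)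
    (hp : p ∈ Ioo (0 : ℝ) 1) (hiss : IsStrictISS h p) (hC : IsCopula C)
    (hopt : UnivOptimal P h C) {a b : ℝ} (ha0 : 0 ≤ a) (hap : a ≤ p) (hb0 : 0 ≤ b)
    (hbp : b ≤ p) :
    upperJoint C a b = max (a + b - p) 0 := by
  have hpp := hopt.upperJoint_inflection hP hdist hp hiss hC
  obtain ⟨hp0, hp1⟩ := hp
  have hq : 1 - p ∈ Icc (0 : ℝ) 1 := ⟨by linarith, by linarith⟩
  have hu : 1 - a ∈ Icc (0 : ℝ) 1 := ⟨by linarith, by linarith⟩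
  have hv : 1 - b ∈ Icc (0 : ℝ) 1 := ⟨by linarith, by linarith⟩
  have m1 := (hC.mono_right hq hq hv (by linarith)).1
  have m2 := (hC.mono_left hv hq hu (by linarith)).1
  obtain ⟨u1, u2⟩ := le_min_iff.1 (hC.le_min hu hv)
  obtain ⟨l1, l2⟩ := max_le_iff.1 (hC.max_le hu hv)
  have hlow : max (a + b - p) 0 ≤ upperJoint C a b := by
    unfold upperJoint at hpp ⊢
    exact max_le (by linarith) (by linarith)
  have hua : upperJoint C a b ≤ a := by unfold upperJoint; linarith
  have hub : upperJoint C a b ≤ b := by unfold upperJoint; linarith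
  have hopt' := hopt.upperJoint_le hP hdist hC (a := a) (b := b) (c := max (a + b - p) 0)
    (le_max_right _ _) (max_le (by linarith) ha0)
    (max_le (by linarith) hb0) ((by linarith : a + b - 1 ≤ a + b - p).trans (le_max_left _ _))
  by_contra hne
  have hlt := lt_of_le_of_ne hlow (Ne.symm hne)
  have hstrict : h (max (a + b - p) 0) + h (a + b - max (a + b - p) 0) <
      h (upperJoint C a b) + h (a + b - upperJoint C a b) :=
    hiss.2.1.add_lt_add_of_Ioo (hiss.1.mono (Icc_subset_Icc_right hp1.le)) (le_max_right _ _)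
      (by linarith [le_max_left (a + b - p) 0]) hlt (by linarith) (by ring)
  linarith

theorem UnivOptimal.eq_Cpm (hP : AtomlessProb P) (hdist : IsDistortion h)
    (hp : p ∈ Ioo (0 : ℝ) 1) (hiss : IsStrictISS h p) (hC : IsCopula C)
    (hopt : UnivOptimal P h C) {u v : ℝ} (hu : u ∈ Icc (0 : ℝ) 1) (hv : v ∈ Icc (0 : ℝ) 1) :
    C u v = Cpm p u v := by
  have hpp := hopt.upperJoint_inflection hP hdist hp hiss hC
  unfold Cpm
  split_ifs with hmin
  · have hq : 1 - p ∈ Icc (0 : ℝ) 1 := ⟨by linarith [hp.2], by linarith [hp.1]⟩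
    have hm : min u v ∈ Icc (0 : ℝ) 1 := ⟨le_min hu.1 hv.1, (min_le_left _ _).trans hu.2⟩
    have l1 := (hC.mono_right hq hm hq hmin).2
    have l2 := (hC.mono_left hm hm hq hmin).2
    have hdiag := hopt.upperJoint_diag_of_inflection_le hP hdist hp hiss hC (a := 1 - min u v)
      ⟨by linarith [hm.2], by linarith [hm.1]⟩ (by
        simp only [upperJoint, sub_sub_cancel] at hpp ⊢
        linarith)
    simp only [upperJoint, sub_sub_cancel] at hdiag
    have m1 := (hC.mono_right hm hm hv (min_le_right _ _)).1
    have m2 := (hC.mono_left hv hm hu (min_le_left _ _)).1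
    have := hC.le_min hu hv
    linarith
  · push Not at hmin
    obtain ⟨h1, h2⟩ := lt_min_iff.1 hmin
    have := hopt.upperJoint_of_le_inflection hP hdist hp hiss hC (a := 1 - u) (b := 1 - v)
      (by linarith [hu.2]) (by linarith) (by linarith [hv.2]) (by linarith)
    simp only [upperJoint, sub_sub_cancel] at this
    rcases max_cases (1 - u + (1 - v) - p) 0 with ⟨e, h3⟩ | ⟨e, h3⟩ <;>
    rcases max_cases (u + v - 1) (1 - p) with ⟨e', h4⟩ | ⟨e', h4⟩ <;> linarith

theorem UnivOptimal.increment_le (hP : AtomlessProb P) (hdist : IsDistortion h)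
    (hp : p ∈ Ioo (0 : ℝ) 1) (hiss : IsStrictISS h p) (hC : IsCopula C)
    (hopt : UnivOptimal P h C) {ε : ℝ} (hε0 : 0 ≤ ε) (hεp : ε ≤ p) (hε1 : ε ≤ 1 - p) :
    h ε + h p ≤ h (p + ε) := by
  have hj := hopt.upperJoint_of_le_inflection hP hdist hp hiss hC hp.1.le le_rfl hε0 hεp
  rw [add_sub_cancel_left, max_eq_left hε0] at hj
  have := hopt.upperJoint_le hP hdist hC (c := 0) le_rfl hp.1.le hε0 (by linarith)
  rw [hj, hdist.2.1, add_sub_cancel_right, sub_zero, add_zero] at this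
  linarith

theorem UnivOptimal.deriv_le_deriv (hP : AtomlessProb P) (hdist : IsDistortion h)
    (hp : p ∈ Ioo (0 : ℝ) 1) (hiss : IsStrictISS h p) (hC : IsCopula C)
    (hopt : UnivOptimal P h C) {d0 dp : ℝ} (hd0 : HasDerivWithinAt h d0 (Ioi 0) 0)
    (hdp : HasDerivWithinAt h dp (Ioi p) p) : d0 ≤ dp := by
  have hshift : HasDerivWithinAt (fun ε => h (p + ε)) dp (Ioi 0) 0 := by
    have hdp' : HasDerivWithinAt h dp (Ioi p) (p + 0) := by rwa [add_zero]
    have := hdp'.comp (0 : ℝ) ((hasDerivWithinAt_id (0 : ℝ) (Ioi 0)).const_add p)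
      fun ε (hε : 0 < ε) => show p < p + ε by linarith
    rwa [mul_one] at this
  have hslope := (hasDerivWithinAt_iff_tendsto_slope' self_notMem_Ioi).1 (hshift.sub hd0)
  have hnear : Ioo 0 (min p (1 - p)) ∈ nhdsWithin (0 : ℝ) (Ioi 0) :=
    Ioo_mem_nhdsGT (lt_min hp.1 (by linarith [hp.2]))
  refine sub_nonneg.1 (ge_of_tendsto hslope (Filter.mem_of_superset hnear fun ε hε => ?_))
  obtain ⟨h1, h2⟩ := lt_min_iff.1 hε.2
  have := hopt.increment_le hP hdist hp hiss hC hε.1.le h1.le h2.le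
  simp only [mem_ofPred_eq, slope_def_field, Pi.sub_apply, add_zero, sub_zero, hdist.2.1]
  exact div_nonneg (by linarith) hε.1.le

end Necessity

/-- Necessity in the ISS characterization: if h is strictly ISS with
inflection point p and the copula C is universally optimal for h with linear cost,
then C = C^±_p on the unit square and h'(0⁺) ≤ h'(p⁺). -/
theorem univOptimal_implies_Cpm_and_deriv_condition_of_strictISS
    (P : Measure Ω) [IsProbabilityMeasure P] (hP : AtomlessProb P)
    (h : ℝ → ℝ) (hdist : IsDistortion h)
    (p : ℝ) (hp : p ∈ Ioo (0:ℝ) 1) (hiss : IsStrictISS h p)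
    (C : ℝ → ℝ → ℝ) (hC : IsCopula C) (hopt : UnivOptimal P h C) :
    (∀ u ∈ Icc (0:ℝ) 1, ∀ v ∈ Icc (0:ℝ) 1, C u v = Cpm p u v) ∧
    (∀ d0 dp : ℝ, HasDerivWithinAt h d0 (Ioi 0) 0 →
      HasDerivWithinAt h dp (Ioi p) p → d0 ≤ dp) :=
  ⟨fun _ hu _ hv => hopt.eq_Cpm hP hdist hp hiss hC hu hv,
    fun _ _ hd0 hdp => hopt.deriv_le_deriv hP hdist hp hiss hC hd0 hdp⟩
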